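/- Let s > 0 and let u, v be adjacent sites of the triangular lattice Λ_s with edge length s (i.e. dist(u,v) = s). Then for every point x in the flower region F(u) and every point y in the flower region F(v), one has dist(x, y) ≤ 2s. Consequently, in a random geometric graph in which every node has transmission radius at least 2s, any node located in F(u) and any node located in F(v) are directly connected by a link. -/

import Mathlib

open MeasureTheory Metric Real

/-- The point `(a, b)` of the Euclidean plane. -/
noncomputable def planePt (a b : ℝ) : EuclideanSpace ℝ (Fin 2) :=
  (WithLp.equiv 2 (Fin 2 → ℝ)).symm ![a, b]

/-- The triangular lattice with edge length `s`:
`Λ_s = {i·s·(1,0) + j·s·(1/2, √3/2) : i, j ∈ ℤ}`. -/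
noncomputable def triLattice (s : ℝ) : Set (EuclideanSpace ℝ (Fin 2)) :=
  {v | ∃ i j : ℤ, v = ((i : ℝ) * s) • planePt 1 0
    + ((j : ℝ) * s) • planePt (1 / 2) (Real.sqrt 3 / 2)}

/-- The flower region around a site `v` of the triangular lattice with edge length `s`:
the intersection of the six closed disks of radius `s` centered at the midpoints
`v + (s/2)·(cos(kπ/3), sin(kπ/3))`, `k = 0,…,5`, of the edges incident to `v`. -/
noncomputable def flower (s : ℝ) (v : EuclideanSpace ℝ (Fin 2)) :
    Set (EuclideanSpace ℝ (Fin 2)) :=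
  ⋂ k : Fin 6, closedBall
    (v + (s / 2) • planePt (Real.cos ((k : ℕ) * Real.pi / 3))
      (Real.sin ((k : ℕ) * Real.pi / 3))) s

/-- The cosine and sine of `kπ/3` for `k = 0,…,5`. -/
theorem cos_sin_nat_mul_pi_div_three (k : Fin 6) :
    Real.cos ((k : ℕ) * Real.pi / 3) = (![1, 1 / 2, -1 / 2, -1, -1 / 2, 1 / 2] : Fin 6 → ℝ) k ∧
    Real.sin ((k : ℕ) * Real.pi / 3) =
      (![0, √3 / 2, √3 / 2, 0, -√3 / 2, -√3 / 2] : Fin 6 → ℝ) k := by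
  have h2 : 2 * Real.pi / 3 = Real.pi - Real.pi / 3 := by ring
  have h3 : 3 * Real.pi / 3 = Real.pi := by ring
  have h4 : 4 * Real.pi / 3 = Real.pi / 3 + Real.pi := by ring
  have h5 : 5 * Real.pi / 3 = 2 * Real.pi - Real.pi / 3 := by ring
  fin_cases k <;>
    simp [h2, h3, h4, h5, Real.cos_pi_sub, Real.sin_pi_sub, Real.cos_add_pi, Real.sin_add_pi,
      Real.cos_two_pi_sub, Real.sin_two_pi_sub, neg_div]

/-- The integer solutions of `a² + ab + b² = 1`. -/
theorem eisenstein_norm_eq_one {a b : ℤ} (h : a ^ 2 + a * b + b ^ 2 = 1) :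
    (a = 1 ∧ b = 0) ∨ (a = 0 ∧ b = 1) ∨ (a = -1 ∧ b = 1) ∨
    (a = -1 ∧ b = 0) ∨ (a = 0 ∧ b = -1) ∨ (a = 1 ∧ b = -1) := by
  have ha : -1 ≤ a ∧ a ≤ 1 := by constructor <;> nlinarith [sq_nonneg (a + 2 * b)]
  have hb : -1 ≤ b ∧ b ≤ 1 := by constructor <;> nlinarith [sq_nonneg (2 * a + b)]
  obtain ⟨ha₁, ha₂⟩ := ha
  obtain ⟨hb₁, hb₂⟩ := hb
  interval_cases a <;> interval_cases b <;> simp_all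

/-- Adjacent sites share the midpoint of the edge between them. -/
theorem exists_common_edge_midpoint {s : ℝ} (hs : 0 < s) {u v : EuclideanSpace ℝ (Fin 2)}
    (hu : u ∈ triLattice s) (hv : v ∈ triLattice s) (hadj : dist u v = s) :
    ∃ k l : Fin 6,
      u + (s / 2) • planePt (Real.cos ((k : ℕ) * Real.pi / 3))
        (Real.sin ((k : ℕ) * Real.pi / 3)) =
      v + (s / 2) • planePt (Real.cos ((l : ℕ) * Real.pi / 3))
        (Real.sin ((l : ℕ) * Real.pi / 3)) := by
  obtain ⟨i, j, rfl⟩ := hu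
  obtain ⟨i', j', rfl⟩ := hv
  have hnorm : (i' - i) ^ 2 + (i' - i) * (j' - j) + (j' - j) ^ 2 = 1 := by
    have h3 : √3 ^ 2 = 3 := Real.sq_sqrt (by norm_num)
    have hsq := congrArg (· ^ 2) hadj
    simp only [EuclideanSpace.dist_sq_eq, Fin.sum_univ_two, Real.dist_eq, sq_abs] at hsq
    simp [planePt] at hsq
    have hmul : s ^ 2 * (((i' - i) ^ 2 + (i' - i) * (j' - j) + (j' - j) ^ 2 : ℤ) : ℝ) =
        s ^ 2 * 1 := by
      push_cast
      linear_combination hsq - s ^ 2 * (j' - j) ^ 2 / 4 * h3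
    exact_mod_cast mul_left_cancel₀ (by positivity) hmul
  simp only [fun k => (cos_sin_nat_mul_pi_div_three k).1, fun k => (cos_sin_nat_mul_pi_div_three k).2]
  rcases eisenstein_norm_eq_one hnorm with h | h | h | h | h | h
  on_goal 1 => refine ⟨0, 3, ?_⟩
  on_goal 2 => refine ⟨1, 4, ?_⟩
  on_goal 3 => refine ⟨2, 5, ?_⟩
  on_goal 4 => refine ⟨3, 0, ?_⟩
  on_goal 5 => refine ⟨4, 1, ?_⟩
  on_goal 6 => refine ⟨5, 2, ?_⟩
  all_goals
    obtain ⟨ha, hb⟩ := h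
    obtain rfl := eq_add_of_sub_eq ha
    obtain rfl := eq_add_of_sub_eq hb
    ext w
    fin_cases w <;> simp [planePt] <;> ring

/-- If `u` and `v` are adjacent sites of the triangular lattice with edge
length `s` (i.e. `dist u v = s`), then any point of `F(u)` and any point of `F(v)` are
within distance `2s`; consequently, nodes with transmission radius at least `2s` located in
`F(u)` and `F(v)` are directly connected by a link. -/
theorem flower_adjacent_dist_le (s : ℝ) (hs : 0 < s)
    (u v : EuclideanSpace ℝ (Fin 2)) (hu : u ∈ triLattice s) (hv : v ∈ triLattice s)
    (hadj : dist u v = s) :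
    ∀ x ∈ flower s u, ∀ y ∈ flower s v,
      dist x y ≤ 2 * s ∧ ∀ ρ : ℝ, 2 * s ≤ ρ → dist x y ≤ ρ := by
  intro x hx y hy
  obtain ⟨k, l, hkl⟩ := exists_common_edge_midpoint hs hu hv hadj
  have hxk := mem_closedBall.1 (Set.mem_iInter.1 hx k)
  have hyl := mem_closedBall.1 (Set.mem_iInter.1 hy l)
  rw [← hkl] at hyl
  have hxy : dist x y ≤ 2 * s := by
    linarith [dist_triangle_right x y (u + (s / 2) • planePt
      (Real.cos ((k : ℕ) * Real.pi / 3)) (Real.sin ((k : ℕ) * Real.pi / 3)))]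
  exact ⟨hxy, fun _ hρ => hxy.trans hρ⟩
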